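/- Fix a probability distribution P on 𝒳. For all probability distributions p and q on 𝒳 such that p(x) = q(x) = 0 whenever P(x) = 0, if ‖p − q‖₁ ≤ 1/2 then |D(p‖P) − D(q‖P)| ≤ −‖p − q‖₁ log( ‖p − q‖₁ / |𝒳| ) − ‖p − q‖₁ log min{ P(x) : x ∈ 𝒳, P(x) > 0 }. -/

import Mathlib

open scoped BigOperators

/-- `p` is a probability distribution on the finite set `X`. -/
def IsDist {X : Type*} [Fintype X] (p : X → ℝ) : Prop :=
  (∀ x, 0 ≤ p x) ∧ ∑ x, p x = 1

/-- `V` is a conditional probability distribution on `Y` given `X`. -/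
def IsCondDist {X Y : Type*} [Fintype Y] (V : X → Y → ℝ) : Prop :=
  ∀ x, IsDist (V x)

/-- Mutual information `I(q,V)` with the convention `0 log 0 = 0`. -/
noncomputable def mutInfo {X Y : Type*} [Fintype X] [Fintype Y]
    (q : X → ℝ) (V : X → Y → ℝ) : ℝ :=
  ∑ x, ∑ y, if q x * V x y = 0 then 0
    else q x * V x y * Real.log (V x y / ∑ x', q x' * V x' y)

/-- The rate-distortion function `R(Δ|q)`. -/
noncomputable def rateDist {X Y : Type*} [Fintype X] [Fintype Y]
    (d : X → Y → ℝ) (Δ : ℝ) (q : X → ℝ) : ℝ :=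
  sInf { r | ∃ V : X → Y → ℝ, IsCondDist V ∧
    (∑ x, ∑ y, q x * V x y * d x y) ≤ Δ ∧ r = mutInfo q V }

/-- Relative entropy `D(q‖P)` (real-valued; convention `0 log 0 = 0`). -/
noncomputable def relEnt {X : Type*} [Fintype X] (q P : X → ℝ) : ℝ :=
  ∑ x, if q x = 0 then 0 else q x * Real.log (q x / P x)

/-- Absolute continuity: `q(x) = 0` whenever `P(x) = 0` (finiteness of `D(q‖P)`). -/
def AbsCont {X : Type*} (q P : X → ℝ) : Prop := ∀ x, P x = 0 → q x = 0

namespace Real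

lemma negMulLog_add_le {a t : ℝ} (ha : 0 ≤ a) (ht : 0 ≤ t) :
    negMulLog (a + t) ≤ negMulLog a + negMulLog t := by
  rcases ha.eq_or_lt with rfl | ha
  · simp
  rcases ht.eq_or_lt with rfl | ht
  · simp
  have h₁ := mul_le_mul_of_nonneg_left (log_le_log ha (by linarith : a ≤ a + t)) ha.le
  have h₂ := mul_le_mul_of_nonneg_left (log_le_log ht (by linarith : t ≤ a + t)) ht.le
  simp only [negMulLog]
  linarith

lemma negMulLog_one_sub_le {t : ℝ} (ht : 0 ≤ t) (ht' : t ≤ 1 / 2) :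
    negMulLog (1 - t) ≤ negMulLog t := by
  rcases ht.eq_or_lt with rfl | ht
  · simp
  have hpos : 0 < 1 - t := by linarith
  have h := strictConcaveOn_log_Ioi.concaveOn.2 (Set.mem_Ioi.2 ht) (Set.mem_Ioi.2 one_pos)
    (div_nonneg ht.le hpos.le) (div_nonneg (by linarith : 0 ≤ 1 - 2 * t) hpos.le)
    (by field_simp; ring)
  have hcomb : t / (1 - t) * t + (1 - 2 * t) / (1 - t) * 1 = 1 - t := by
    field_simp; ring
  simp only [smul_eq_mul, hcomb, log_one, mul_zero, add_zero] at h
  rw [div_mul_eq_mul_div, div_le_iff₀ hpos] at h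
  simp only [negMulLog]
  linarith

lemma negMulLog_sub_negMulLog_add_le {a t : ℝ} (ha : 0 ≤ a) (ht : 0 ≤ t) (hat : a + t ≤ 1) :
    negMulLog a - negMulLog (a + t) ≤ negMulLog (1 - t) := by
  rcases ht.eq_or_lt with rfl | ht
  · simp
  have hpos : 0 < 1 - a := by linarith
  have hs : 0 ≤ 1 - a - t := by linarith
  have h₁ := concaveOn_negMulLog.2 (Set.mem_Ici.2 ha) (Set.mem_Ici.2 zero_le_one)
    (div_nonneg hs hpos.le) (div_nonneg ht.le hpos.le) (by field_simp; ring)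
  have h₂ := concaveOn_negMulLog.2 (Set.mem_Ici.2 ha) (Set.mem_Ici.2 zero_le_one)
    (div_nonneg ht.le hpos.le) (div_nonneg hs hpos.le) (by field_simp; ring)
  have hc₁ : (1 - a - t) / (1 - a) * a + t / (1 - a) * 1 = a + t := by field_simp; ring
  have hc₂ : t / (1 - a) * a + (1 - a - t) / (1 - a) * 1 = 1 - t := by field_simp; ring
  simp only [smul_eq_mul, hc₁, hc₂, negMulLog_one, mul_zero, add_zero] at h₁ h₂
  have hsum : (1 - a - t) / (1 - a) * negMulLog a + t / (1 - a) * negMulLog a = negMulLog a := by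
    field_simp; ring
  linarith

lemma abs_negMulLog_sub_le {a b : ℝ} (ha : 0 ≤ a) (ha' : a ≤ 1) (hb : 0 ≤ b) (hb' : b ≤ 1)
    (hab : |a - b| ≤ 1 / 2) :
    |negMulLog a - negMulLog b| ≤ negMulLog |a - b| := by
  wlog h : b ≤ a generalizing a b
  · rw [abs_sub_comm, abs_sub_comm a b]
    exact this hb hb' ha ha' (by rwa [abs_sub_comm]) (le_of_not_ge h)
  have ht : 0 ≤ a - b := sub_nonneg.2 h
  rw [abs_of_nonneg ht] at hab ⊢
  have h₁ := negMulLog_add_le hb ht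
  have h₂ := negMulLog_sub_negMulLog_add_le hb ht (by linarith)
  have h₃ := negMulLog_one_sub_le ht hab
  rw [add_sub_cancel] at h₁ h₂
  exact abs_le.2 ⟨by linarith, by linarith⟩

lemma negMulLog_le_of_pos {t c : ℝ} (ht : 0 ≤ t) (hc : 0 < c) :
    negMulLog t ≤ -t * log c + (c - t) := by
  rcases ht.eq_or_lt with rfl | ht
  · simpa using hc.le
  have h := mul_le_mul_of_nonneg_left (log_le_sub_one_of_pos (div_pos hc ht)) ht.le
  rw [log_div hc.ne' ht.ne', mul_sub t (c / t), mul_div_cancel₀ _ ht.ne'] at h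
  simp only [negMulLog]
  linarith

lemma sum_negMulLog_le {X : Type*} [Fintype X] {t : X → ℝ} (ht : ∀ x, 0 ≤ t x) :
    ∑ x, negMulLog (t x) ≤ -(∑ x, t x) * log ((∑ x, t x) / Fintype.card X) := by
  rcases (Finset.sum_nonneg fun x _ => ht x).eq_or_lt with h0 | hpos
  · have h : ∀ x, t x = 0 := fun x =>
      (Finset.sum_eq_zero_iff_of_nonneg fun x _ => ht x).1 h0.symm x (Finset.mem_univ x)
    simp [h]
  have hne : Nonempty X := by
    by_contra hX
    rw [not_nonempty_iff] at hX
    simp at hpos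
  have hn : (0 : ℝ) < Fintype.card X := Nat.cast_pos.2 Fintype.card_pos
  refine (Finset.sum_le_sum fun x _ => negMulLog_le_of_pos (ht x) (div_pos hpos hn)).trans_eq ?_
  rw [Finset.sum_add_distrib, ← Finset.sum_mul, Finset.sum_neg_distrib, Finset.sum_sub_distrib,
    Finset.sum_const, Finset.card_univ, nsmul_eq_mul, mul_div_cancel₀ _ hn.ne', sub_self, add_zero]

end Real

lemma IsDist.le_one {X : Type*} [Fintype X] {p : X → ℝ} (hp : IsDist p) (x : X) : p x ≤ 1 :=
  hp.2 ▸ Finset.single_le_sum (fun y _ => hp.1 y) (Finset.mem_univ x)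

lemma relEnt_eq_sum {X : Type*} [Fintype X] {p P : X → ℝ} (h : AbsCont p P) :
    relEnt p P = ∑ x, (-Real.negMulLog (p x) - p x * Real.log (P x)) := by
  refine Finset.sum_congr rfl fun x _ => ?_
  split_ifs with hx
  · simp [hx]
  · rw [Real.log_div hx fun hPx => hx (h x hPx), Real.negMulLog]
    ring

lemma log_sInf_support_le {X : Type*} [Fintype X] {P : X → ℝ} {x : X} (hx : 0 < P x) :
    Real.log (sInf { t | ∃ x, 0 < P x ∧ t = P x }) ≤ Real.log (P x) := by
  set S := { t | ∃ x, 0 < P x ∧ t = P x }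
  have hS : S.Finite := (Set.finite_range P).subset <| by
    rintro _ ⟨y, -, rfl⟩
    exact ⟨y, rfl⟩
  have hxS : P x ∈ S := ⟨x, hx, rfl⟩
  obtain ⟨y, hy, hmin⟩ := Set.Nonempty.csInf_mem ⟨_, hxS⟩ hS
  exact Real.log_le_log (hmin ▸ hy) (csInf_le hS.bddBelow hxS)

/-- Lemma 10: an `L₁` bound on the difference of relative entropies. -/
theorem relEnt_L1_bound
    {X : Type*} [Fintype X] [Nonempty X]
    (P : X → ℝ) (hP : IsDist P)
    (p q : X → ℝ) (hp : IsDist p) (hq : IsDist q)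
    (habsp : AbsCont p P) (habsq : AbsCont q P)
    (h1 : ∑ x, |p x - q x| ≤ 1 / 2) :
    |relEnt p P - relEnt q P|
      ≤ -(∑ x, |p x - q x|) *
          Real.log ((∑ x, |p x - q x|) / (Fintype.card X : ℝ))
        - (∑ x, |p x - q x|) *
          Real.log (sInf { t | ∃ x, 0 < P x ∧ t = P x }) := by
  rw [relEnt_eq_sum habsp, relEnt_eq_sum habsq, ← Finset.sum_sub_distrib]
  set L := Real.log (sInf { t | ∃ x, 0 < P x ∧ t = P x })
  have hterm : ∀ x, |(-Real.negMulLog (p x) - p x * Real.log (P x)) -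
      (-Real.negMulLog (q x) - q x * Real.log (P x))| ≤
      Real.negMulLog |p x - q x| - |p x - q x| * L := by
    intro x
    have hle : |p x - q x| ≤ 1 / 2 :=
      (Finset.single_le_sum (fun y _ => abs_nonneg (p y - q y)) (Finset.mem_univ x)).trans h1
    have hη := Real.abs_negMulLog_sub_le (hp.1 x) (hp.le_one x) (hq.1 x) (hq.le_one x) hle
    have hlog : |p x - q x| * |Real.log (P x)| ≤ |p x - q x| * -L := by
      rcases (hP.1 x).eq_or_lt with h0 | hpos
      · simp [habsp x h0.symm, habsq x h0.symm]
      · rw [abs_of_nonpos (Real.log_nonpos hpos.le (hP.le_one x))]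
        exact mul_le_mul_of_nonneg_left (neg_le_neg (log_sInf_support_le hpos)) (abs_nonneg _)
    calc _ = |(Real.negMulLog (p x) - Real.negMulLog (q x)) + (p x - q x) * Real.log (P x)| := by
          rw [← abs_neg]; ring_nf
      _ ≤ _ := abs_add_le _ _
      _ ≤ _ := by rw [abs_mul]; linarith
  refine (Finset.abs_sum_le_sum_abs _ _).trans <|
    (Finset.sum_le_sum fun x _ => hterm x).trans ?_
  rw [Finset.sum_sub_distrib, ← Finset.sum_mul]
  exact sub_le_sub_right (Real.sum_negMulLog_le fun x => abs_nonneg _) _
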